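/- Let f be an orientation preserving circle homeomorphism with non-zero rational rotation number and minimal period n_f. Then f is strongly reversible in Homeo(S¹) if and only if f^{n_f} is strongly reversible by an orientation reversing involution. -/

import Mathlib

noncomputable section

open scoped Classical

local instance : Fact ((0:ℝ) < 1) := ⟨zero_lt_one⟩

/-- The circle `S¹`, realised as `ℝ / ℤ`. -/
abbrev S1 := AddCircle (1 : ℝ)

/-- `F` is a (monotone, degree one) lift of the circle homeomorphism `f`. -/
def IsLiftOf (f : S1 ≃ₜ S1) (F : CircleDeg1Lift) : Prop :=
  ∀ x : ℝ, f (x : S1) = ((F x : ℝ) : S1)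

/-- A circle homeomorphism is orientation preserving iff it admits a monotone degree one lift. -/
def OrientationPreserving (f : S1 ≃ₜ S1) : Prop :=
  ∃ F : CircleDeg1Lift, IsLiftOf f F

/-- A circle homeomorphism is orientation reversing iff it admits a strictly decreasing
degree `-1` lift. -/
def OrientationReversing (f : S1 ≃ₜ S1) : Prop :=
  ∃ F : ℝ → ℝ, StrictAnti F ∧ (∀ x : ℝ, F (x + 1) = F x - 1) ∧
    ∀ x : ℝ, f (x : S1) = ((F x : ℝ) : S1)

/-- `f` has (Poincaré) rotation number `r` (mod 1): some lift has translation number `r`. -/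
def HasRotationNumber (f : S1 ≃ₜ S1) (r : ℝ) : Prop :=
  ∃ F : CircleDeg1Lift, IsLiftOf f F ∧ F.translationNumber = r

/-- An involution. -/
def IsInvolution (f : S1 ≃ₜ S1) : Prop := ∀ x, f (f x) = x

/-- The canonical representative of a point of the circle in `[0, 1)`. -/
def rep (x : S1) : ℝ := (AddCircle.equivIco 1 0 x : ℝ)

/-- The signature of a circle homeomorphism with respect to a lift `F`; when `F` is the
(unique) lift with a fixed point of an orientation preserving homeomorphism with a fixed
point, this is the signature function `Δ_f : S¹ → {-1, 0, 1}`. -/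
def signature (F : CircleDeg1Lift) (x : S1) : ℝ := Real.sign (F (rep x) - rep x)

/-- Strong reversibility in `Homeo⁺(S¹)`. -/
def StronglyReversiblePlus (f : S1 ≃ₜ S1) : Prop :=
  ∃ σ : S1 ≃ₜ S1, OrientationPreserving σ ∧ IsInvolution σ ∧ ∀ x, σ (f (σ x)) = f.symm x

/-- Strong reversibility in the full group `Homeo(S¹)`. -/
def StronglyReversible (f : S1 ≃ₜ S1) : Prop :=
  ∃ τ : S1 ≃ₜ S1, IsInvolution τ ∧ ∀ x, τ (f (τ x)) = f.symm x

section CircleLifts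

theorem exists_int_of_coe_eq {x y : ℝ} (h : (x : S1) = (y : S1)) : ∃ k : ℤ, x = y + k := by
  have h0 : ((x - y : ℝ) : S1) = 0 := by rw [AddCircle.coe_sub, h, sub_self]
  obtain ⟨k, hk⟩ := (AddCircle.coe_eq_zero_iff (1 : ℝ)).1 h0
  refine ⟨k, ?_⟩
  simp only [zsmul_eq_mul, mul_one] at hk
  linarith

theorem coe_add_intCast (x : ℝ) (k : ℤ) : ((x + k : ℝ) : S1) = x := by
  rw [AddCircle.coe_add, add_eq_left]
  exact (AddCircle.coe_eq_zero_iff (1 : ℝ)).2 ⟨k, by simp⟩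

theorem exists_int_add_of_coe_eq {A B : ℝ → ℝ} (hA : Continuous A) (hB : Continuous B)
    (h : ∀ x, (A x : S1) = (B x : S1)) : ∃ m : ℤ, ∀ x, A x = B x + m := by
  obtain ⟨m, hm⟩ := exists_int_of_coe_eq (h 0)
  refine ⟨m, fun x => congrFun ((AddCircle.isCoveringMap_coe (1 : ℝ)).eq_of_comp_eq hA
    (hB.add continuous_const) (funext fun y => ?_) 0 hm) x⟩
  exact (h y).trans (coe_add_intCast (B y) m).symm

theorem map_add_intCast {G : ℝ → ℝ} {d : ℤ} (hG : ∀ x, G (x + 1) = G x + d) (x : ℝ) (k : ℤ) :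
    G (x + k) = G x + k * d := by
  induction k using Int.induction_on with
  | zero => simp
  | succ i ih =>
    push_cast at ih ⊢
    rw [← add_assoc, hG, ih]
    ring
  | pred i ih =>
    have h := hG (x + (-(i : ℝ) - 1))
    rw [show x + (-(i : ℝ) - 1) + 1 = x + -(i : ℝ) by ring] at h
    push_cast at ih ⊢
    linarith

theorem surjective_of_lift {g : S1 ≃ₜ S1} {G : ℝ → ℝ} {d : ℤ} (hd : d * d = 1)
    (hG : ∀ x, G (x + 1) = G x + d) (h : ∀ x : ℝ, g (x : S1) = ((G x : ℝ) : S1)) :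
    Function.Surjective G := by
  intro y
  obtain ⟨x, hx⟩ := g.surjective (y : S1)
  obtain ⟨x, rfl⟩ := QuotientAddGroup.mk_surjective x
  obtain ⟨k, hk⟩ := exists_int_of_coe_eq ((h x).symm.trans hx)
  refine ⟨x + ((-k * d : ℤ) : ℝ), ?_⟩
  rw [map_add_intCast hG, hk]
  have hd' : (d : ℝ) * d = 1 := mod_cast hd
  push_cast
  linear_combination (-(k : ℝ)) * hd'

theorem IsLiftOf.continuous {f : S1 ≃ₜ S1} {F : CircleDeg1Lift} (h : IsLiftOf f F) :
    Continuous F :=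
  F.monotone.continuous_of_surjective
    (surjective_of_lift (d := 1) rfl (fun x => by simp) h)

theorem IsLiftOf.iterate {f : S1 ≃ₜ S1} {F : CircleDeg1Lift} (h : IsLiftOf f F) (n : ℕ) (x : ℝ) :
    (⇑f)^[n] (x : S1) = ((F^[n] x : ℝ) : S1) := by
  induction n generalizing x with
  | zero => rfl
  | succ n ih => rw [Function.iterate_succ_apply, Function.iterate_succ_apply, h x, ih]

theorem exists_continuous_lift (g : S1 ≃ₜ S1) :
    ∃ G : ℝ → ℝ, Continuous G ∧ ∀ x : ℝ, g (x : S1) = ((G x : ℝ) : S1) := by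
  obtain ⟨e, he⟩ := QuotientAddGroup.mk_surjective (g ((0 : ℝ) : S1))
  obtain ⟨G, ⟨-, hG⟩, -⟩ :=
    (AddCircle.isCoveringMap_coe (1 : ℝ)).existsUnique_continuousMap_lifts
      ⟨fun x : ℝ => g (x : S1), g.continuous.comp (AddCircle.continuous_mk' 1)⟩ 0 e he
  exact ⟨G, G.continuous, fun x => (congrFun hG x).symm⟩

end CircleLifts

theorem conj_iterate {f τ : S1 ≃ₜ S1} (hτ : IsInvolution τ) (h : ∀ x, τ (f (τ x)) = f.symm x)
    (n : ℕ) (x : S1) : τ ((⇑f)^[n] (τ x)) = (⇑f.symm)^[n] x := by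
  induction n generalizing x with
  | zero => exact hτ x
  | succ n ih =>
    rw [Function.iterate_succ_apply, Function.iterate_succ_apply, ← ih, ← h, hτ]

section Involutions

/-- A lift of an involution is, up to an integer, an involution and has degree `±1`. -/
theorem exists_lift_of_isInvolution {τ : S1 ≃ₜ S1} (hτ : IsInvolution τ) :
    ∃ (Φ : ℝ → ℝ) (m d : ℤ), Continuous Φ ∧ (∀ x : ℝ, τ (x : S1) = ((Φ x : ℝ) : S1)) ∧
      (∀ x, Φ (Φ x) = x + m) ∧ (∀ x, Φ (x + 1) = Φ x + d) ∧ d * d = 1 := by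
  obtain ⟨Φ, hc, hΦ⟩ := exists_continuous_lift τ
  obtain ⟨m, hm⟩ := exists_int_add_of_coe_eq (hc.comp hc) continuous_id
    (fun x => by simp only [Function.comp_apply, id]; rw [← hΦ, ← hΦ, hτ])
  obtain ⟨d, hd⟩ := exists_int_add_of_coe_eq (A := fun x => Φ (x + 1)) (by fun_prop) hc
    (fun x => by rw [← hΦ, ← hΦ, AddCircle.coe_add_period])
  simp only [Function.comp_apply, id] at hm hd
  refine ⟨Φ, m, d, hc, hΦ, hm, hd, ?_⟩
  have h := hm (0 + 1)
  rw [hd 0, map_add_intCast hd, hm] at h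
  have : (d : ℝ) * d = 1 := by linarith
  exact_mod_cast this

theorem orientationReversing_or_exists_strictMono {τ : S1 ≃ₜ S1} (hτ : IsInvolution τ) :
    OrientationReversing τ ∨ ∃ (Φ : ℝ → ℝ) (m : ℤ), Continuous Φ ∧ StrictMono Φ ∧
      (∀ x : ℝ, τ (x : S1) = ((Φ x : ℝ) : S1)) ∧ (∀ x, Φ (Φ x) = x + m) ∧
      ∀ x, Φ (x + 1) = Φ x + 1 := by
  obtain ⟨Φ, m, d, hc, hΦ, hm, hd, hdd⟩ := exists_lift_of_isInvolution hτ
  have hinj : Function.Injective Φ := fun x y hxy => by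
    have h := hm x
    rw [hxy, hm] at h
    linarith
  have hd1 : d = 1 ∨ d = -1 := Int.eq_one_or_neg_one_of_mul_eq_one hdd
  rcases hc.strictMono_of_inj hinj with h | h
  · right
    have h1 : Φ 0 < Φ (0 + 1) := h (by norm_num)
    rw [hd] at h1
    have h2 : 0 < d := by exact_mod_cast (by linarith : (0 : ℝ) < d)
    obtain rfl : d = 1 := by omega
    exact ⟨Φ, m, hc, h, hΦ, hm, fun x => by simpa using hd x⟩
  · left
    have h1 : Φ (0 + 1) < Φ 0 := h (by norm_num)
    rw [hd] at h1
    have h2 : d < 0 := by exact_mod_cast (by linarith : (d : ℝ) < 0)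
    obtain rfl : d = -1 := by omega
    exact ⟨Φ, h, fun x => by simpa [sub_eq_add_neg] using hd x, hΦ⟩

theorem eq_add_int_of_apply_apply_eq {Φ : ℝ → ℝ} (hΦ : StrictMono Φ)
    (h1 : ∀ x, Φ (x + 1) = Φ x + 1) {k : ℤ} (h : ∀ x, Φ (Φ x) = x + (2 * k : ℤ)) (x : ℝ) :
    Φ x = x + k := by
  have hk : Φ (x + k) = Φ x + k := by
    simpa using map_add_intCast (d := 1) (by simpa using h1) x k
  have hx := h x
  push_cast at hx
  rcases lt_trichotomy (Φ x) (x + k) with hlt | heq | hgt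
  · have := hΦ hlt
    linarith
  · exact heq
  · have := hΦ hgt
    linarith

/-- If a product of two orientation preserving involutions has no fixed point, then one of them
is the identity; in particular it is itself an involution. -/
theorem apply_apply_eq_of_reversed_of_strictMono {f τ : S1 ≃ₜ S1} (hf : OrientationPreserving f)
    (hfix : ∀ x, f x ≠ x) (hτ : IsInvolution τ) (hrev : ∀ x, τ (f (τ x)) = f.symm x)
    {Φ : ℝ → ℝ} {m : ℤ} (hc : Continuous Φ) (hΦ : StrictMono Φ)
    (hlift : ∀ x : ℝ, τ (x : S1) = ((Φ x : ℝ) : S1)) (hm : ∀ x, Φ (Φ x) = x + m)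
    (h1 : ∀ x, Φ (x + 1) = Φ x + 1) (x : S1) : f (f x) = x := by
  obtain ⟨F, hF⟩ := hf
  have hFc := hF.continuous
  have hσ : ∀ x, τ (f (τ (f x))) = x := fun x => by rw [hrev]; simp
  have hne : ∀ (x : ℝ) (k : ℤ), Φ (F x) - Φ x ≠ k := by
    intro x k hk
    refine hfix x (τ.injective ?_)
    rw [hF, hlift, hlift, show Φ (F x) = Φ x + k by linarith, coe_add_intCast]
  have hcont : Continuous fun x => Φ (F x) - Φ x := (hc.comp hFc).sub hc
  set k : ℤ := ⌊Φ (F 0) - Φ 0⌋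
  have hlow : ∀ x, (k : ℝ) < Φ (F x) - Φ x := by
    intro x
    by_contra! hx
    obtain ⟨y, hy⟩ := mem_range_of_exists_le_of_exists_ge hcont ⟨x, hx⟩ ⟨0, Int.floor_le _⟩
    exact hne y k hy
  have hupp : ∀ x, Φ (F x) - Φ x < k + 1 := by
    intro x
    by_contra! hx
    obtain ⟨y, hy⟩ := mem_range_of_exists_le_of_exists_ge hcont
      ⟨0, (Int.lt_floor_add_one _).le⟩ ⟨x, hx⟩
    exact hne y (k + 1) (by push_cast; exact hy)
  -- a lift of `τ ∘ f` lying strictly between `Φ` and `Φ + 1`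
  set S : ℝ → ℝ := fun x => Φ (F x) - k with hS
  have hSc : Continuous S := (hc.comp hFc).sub continuous_const
  have hSlift : ∀ x : ℝ, τ (f (x : S1)) = ((S x : ℝ) : S1) := by
    intro x
    have := coe_add_intCast (Φ (F x)) (-k)
    push_cast at this
    rw [hF, hlift, ← this, ← sub_eq_add_neg]
  obtain ⟨j, hj⟩ := exists_int_add_of_coe_eq (hSc.comp hSc) continuous_id
    (fun x => by simp only [Function.comp_apply, id]; rw [← hSlift, ← hSlift, hσ])
  simp only [Function.comp_apply, id] at hj
  have hΦS : ∀ x, Φ x < S x := fun x => by have := hlow x; simp only [hS]; linarith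
  have hSΦ : ∀ x, S x < Φ x + 1 := fun x => by have := hupp x; simp only [hS]; linarith
  have hS1 : ∀ x, S (x + 1) = S x + 1 := fun x => by
    simp only [hS, F.map_add_one, h1]
    ring
  have hSmono : Monotone S := fun a b hab => by
    simp only [hS]
    linarith [hΦ.monotone (F.monotone hab)]
  have hSstrict : StrictMono S := hSmono.strictMono_of_injective fun a b hab => by
    have h := hj a
    rw [hab, hj] at h
    linarith
  have hmj : j = m + 1 := by
    have a1 := (hΦ (hΦS 0)).trans (hΦS (S 0))
    have a2 := (hSΦ (S 0)).trans (add_lt_add_left (hΦ (hSΦ 0)) 1)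
    rw [hm, hj] at a1
    rw [hj, h1, hm] at a2
    have b1 : m < j := by exact_mod_cast (by linarith : (m : ℝ) < j)
    have b2 : j < m + 2 := by exact_mod_cast (by push_cast; linarith : (j : ℝ) < (m + 2 : ℤ))
    omega
  rcases Int.even_or_odd' m with ⟨l, hl | hl⟩
  · have hid : ∀ y, τ y = y := by
      intro y
      obtain ⟨y, rfl⟩ := QuotientAddGroup.mk_surjective y
      refine (hlift y).trans ?_
      rw [eq_add_int_of_apply_apply_eq hΦ h1 (k := l) (hl ▸ hm) y]
      exact coe_add_intCast y l
    have h := hσ x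
    rwa [hid, hid] at h
  · have hid : ∀ y, τ (f y) = y := by
      intro y
      obtain ⟨y, rfl⟩ := QuotientAddGroup.mk_surjective y
      refine (hSlift y).trans ?_
      rw [eq_add_int_of_apply_apply_eq hSstrict hS1 (k := l + 1)
        (fun x => by rw [hj]; congr 2; omega) y]
      exact coe_add_intCast y (l + 1)
    have hfτ : ∀ y, f y = τ y := fun y => by rw [← hid y, hτ, hid]
    rw [hfτ, hfτ, hτ]

end Involutions

theorem orientationReversing_neg : OrientationReversing (Homeomorph.neg S1) :=
  ⟨fun x => -x, fun _ _ h => neg_lt_neg h, fun x => by ring, fun _ => rfl⟩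

theorem exists_orientationReversing_of_stronglyReversible {f : S1 ≃ₜ S1}
    (hf : OrientationPreserving f) {n : ℕ} (hn : 1 < n)
    (hmin : ∀ m : ℕ, 0 < m → m < n → ¬∃ x, (⇑f)^[m] x = x) (h : StronglyReversible f) :
    ∃ τ : S1 ≃ₜ S1, OrientationReversing τ ∧ IsInvolution τ ∧
      ∀ x, τ ((⇑f)^[n] (τ x)) = (⇑f.symm)^[n] x := by
  obtain ⟨τ, hτ, hrev⟩ := h
  rcases orientationReversing_or_exists_strictMono hτ with ho | ⟨Φ, m, hc, hΦ, hlift, hm, h1⟩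
  · exact ⟨τ, ho, hτ, conj_iterate hτ hrev n⟩
  · have hff := apply_apply_eq_of_reversed_of_strictMono hf
      (fun x hx => hmin 1 one_pos hn ⟨x, hx⟩) hτ hrev hc hΦ hlift hm h1
    obtain rfl : n = 2 := by
      by_contra hne
      exact hmin 2 two_pos (by omega) ⟨0, hff 0⟩
    refine ⟨Homeomorph.neg S1, orientationReversing_neg, fun x => neg_neg x, fun x => ?_⟩
    have hsymm : (⇑f.symm)^[2] x = x := by
      change f.symm (f.symm x) = x
      rw [f.symm_apply_eq, f.symm_apply_eq, hff]
    rw [hsymm]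
    change -(f (f (-x))) = x
    rw [hff, neg_neg]

section PointwiseMaximum

variable {F θ : ℝ → ℝ} {n : ℕ}

/-- The pointwise maximum of the maps `F^i ∘ θ ∘ F^i` for `0 ≤ i ≤ n`. -/
def maxConj (F θ : ℝ → ℝ) (n : ℕ) (x : ℝ) : ℝ :=
  (Finset.range (n + 1)).sup' Finset.nonempty_range_add_one fun i => F^[i] (θ (F^[i] x))

theorem le_maxConj {i : ℕ} (hi : i ≤ n) (x : ℝ) : F^[i] (θ (F^[i] x)) ≤ maxConj F θ n x :=
  Finset.le_sup' (fun i => F^[i] (θ (F^[i] x))) (Finset.mem_range.2 (Nat.lt_succ_of_le hi))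

theorem exists_maxConj_eq (F θ : ℝ → ℝ) (n : ℕ) (x : ℝ) :
    ∃ i ≤ n, maxConj F θ n x = F^[i] (θ (F^[i] x)) := by
  obtain ⟨i, hi, h⟩ := Finset.exists_mem_eq_sup' (s := Finset.range (n + 1))
    Finset.nonempty_range_add_one fun i => F^[i] (θ (F^[i] x))
  exact ⟨i, Nat.lt_succ_iff.1 (Finset.mem_range.1 hi), h⟩

theorem continuous_maxConj (hF : Continuous F) (hθ : Continuous θ) :
    Continuous (maxConj F θ n) :=
  Continuous.finset_sup'_apply _ fun i _ => (hF.iterate i).comp (hθ.comp (hF.iterate i))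

theorem maxConj_add_one (hF : ∀ x, F (x + 1) = F x + 1) (hθ : ∀ x, θ (x + 1) = θ x - 1) (x : ℝ) :
    maxConj F θ n (x + 1) = maxConj F θ n x - 1 := by
  have hFi : ∀ (i : ℕ) (y : ℝ), F^[i] (y + 1) = F^[i] y + 1 := fun i y =>
    (show Function.Commute F (· + 1) from hF).iterate_left i y
  have hFi' : ∀ (i : ℕ) (y : ℝ), F^[i] (y - 1) = F^[i] y - 1 := fun i y => by
    have := hFi i (y - 1)
    rw [sub_add_cancel] at this
    linarith
  have hs : ∀ i : ℕ, F^[i] (θ (F^[i] (x + 1))) = F^[i] (θ (F^[i] x)) - 1 := fun i => by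
    rw [hFi, hθ, hFi']
  apply le_antisymm
  · obtain ⟨i, hi, h⟩ := exists_maxConj_eq F θ n (x + 1)
    rw [h, hs]
    exact sub_le_sub_right (le_maxConj hi x) 1
  · obtain ⟨i, hi, h⟩ := exists_maxConj_eq F θ n x
    rw [h, ← hs]
    exact le_maxConj hi (x + 1)

theorem map_maxConj_map (hF : Monotone F) (hn : 0 < n) (hper : ∀ x, F^[n] (θ (F^[n] x)) = θ x)
    (x : ℝ) : F (maxConj F θ n (F x)) = maxConj F θ n x := by
  have hs : ∀ i : ℕ, F (F^[i] (θ (F^[i] (F x)))) = F^[i + 1] (θ (F^[i + 1] x)) := fun i => by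
    rw [← Function.iterate_succ_apply' F, ← Function.iterate_succ_apply F]
  apply le_antisymm
  · obtain ⟨i, hi, h⟩ := exists_maxConj_eq F θ n (F x)
    rcases hi.lt_or_eq with hi | rfl
    · rw [h, hs]
      exact le_maxConj hi x
    · rw [h, hper]
      exact le_maxConj (F := F) (θ := θ) (i := 1) hn x
  · have key : ∀ i, i < n → F^[i + 1] (θ (F^[i + 1] x)) ≤ F (maxConj F θ n (F x)) := fun i hi => by
      rw [← hs]
      exact hF (le_maxConj hi.le (F x))
    obtain ⟨i, hi, h⟩ := exists_maxConj_eq F θ n x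
    rw [h]
    rcases Nat.eq_zero_or_pos i with rfl | hpos
    · have := key (n - 1) (by omega)
      rw [Nat.sub_add_cancel hn, hper] at this
      exact this
    · have := key (i - 1) (by omega)
      rwa [Nat.sub_add_cancel hpos] at this

/-- The maximum of a family of decreasing bijections that is closed under inversion is an
involution. -/
theorem maxConj_maxConj (hF : Monotone F) (hFinj : Function.Injective F) (hθ : Antitone θ)
    (hθθ : ∀ x, θ (θ x) = x) (hper : ∀ x, F^[n] (θ (F^[n] x)) = θ x) (x : ℝ) :
    maxConj F θ n (maxConj F θ n x) = x := by
  have hinv : ∀ i ≤ n, ∀ y, F^[i] (θ (F^[i] (F^[n - i] (θ (F^[n - i] y))))) = y := by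
    intro i hi y
    apply hFinj.iterate (n - i)
    rw [← Function.iterate_add_apply, ← Function.iterate_add_apply F i (n - i),
      Nat.sub_add_cancel hi, Nat.add_sub_cancel' hi, hper, hθθ]
  have hanti : ∀ i : ℕ, Antitone fun y => F^[i] (θ (F^[i] y)) := fun i a b hab =>
    hF.iterate i (hθ (hF.iterate i hab))
  apply le_antisymm
  · obtain ⟨i, hi, h⟩ := exists_maxConj_eq F θ n (maxConj F θ n x)
    rw [h]
    exact (hanti i (le_maxConj (Nat.sub_le n i) x)).trans_eq (hinv i hi x)
  · obtain ⟨j, hj, h⟩ := exists_maxConj_eq F θ n x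
    have := le_maxConj (F := F) (θ := θ) (Nat.sub_le n j) (maxConj F θ n x)
    rw [h] at this ⊢
    have h2 := hinv (n - j) (Nat.sub_le n j) x
    rw [Nat.sub_sub_self hj] at h2
    rwa [h2] at this

end PointwiseMaximum

theorem exists_homeomorph_of_involution {Θ : ℝ → ℝ} (hc : Continuous Θ)
    (h1 : ∀ x, Θ (x + 1) = Θ x - 1) (hΘ : ∀ x, Θ (Θ x) = x) :
    ∃ τ : S1 ≃ₜ S1, ∀ x : ℝ, τ (x : S1) = ((Θ x : ℝ) : S1) := by
  have hper : Function.Periodic (fun x => (Θ x : S1)) 1 := fun x => by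
    have := AddCircle.coe_add_period (1 : ℝ) (Θ x - 1)
    rw [sub_add_cancel] at this
    simp only [h1, this]
  have hcont : Continuous (hper.lift : S1 → S1) :=
    continuous_coinduced_dom.2 ((AddCircle.continuous_mk' 1).comp hc)
  have hinv : Function.Involutive (hper.lift : S1 → S1) := by
    intro x
    obtain ⟨x, rfl⟩ := QuotientAddGroup.mk_surjective x
    change ((Θ (Θ x) : ℝ) : S1) = x
    rw [hΘ]
  exact ⟨⟨hinv.toPerm, hcont, hcont⟩, fun x => rfl⟩

theorem iterate_conj_lift_eq {f τ : S1 ≃ₜ S1} {F : CircleDeg1Lift} (hF : IsLiftOf f F) {n : ℕ}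
    (hper : ∃ x, (⇑f)^[n] x = x) (hrev : ∀ x, τ ((⇑f)^[n] (τ x)) = (⇑f.symm)^[n] x)
    (hτ : IsInvolution τ) {θ : ℝ → ℝ} (hθc : Continuous θ) (h1 : ∀ x, θ (x + 1) = θ x - 1)
    (hθ : ∀ x : ℝ, τ (x : S1) = ((θ x : ℝ) : S1)) (x : ℝ) : F^[n] (θ (F^[n] x)) = θ x := by
  have hFc := hF.continuous.iterate n
  obtain ⟨m, hm⟩ := exists_int_add_of_coe_eq (hFc.comp (hθc.comp hFc)) hθc (fun x => by
    simp only [Function.comp_apply]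
    rw [← hF.iterate, ← hθ, ← hF.iterate, ← hθ]
    apply τ.injective
    rw [hτ, hrev]
    exact Function.LeftInverse.iterate f.symm_apply_apply n x)
  obtain ⟨z, hz⟩ := hper
  obtain ⟨z, rfl⟩ := QuotientAddGroup.mk_surjective z
  obtain ⟨p, hp⟩ := exists_int_of_coe_eq ((hF.iterate n z).symm.trans hz)
  have hθk : θ (z + p) = θ z - p := by
    have := map_add_intCast (d := -1) (by simpa [sub_eq_add_neg] using h1) z p
    push_cast at this
    linarith
  have hmz := hm z
  simp only [Function.comp_apply] at hmz
  rw [← CircleDeg1Lift.coe_pow] at hp hmz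
  rw [hp, hθk, CircleDeg1Lift.map_sub_int] at hmz
  have t1 := (F ^ n).translationNumber_of_eq_add_int hp
  have t2 := (F ^ n).translationNumber_of_eq_add_int (x := θ z) (m := p + m)
    (by push_cast; linarith)
  rw [t1] at t2
  push_cast at t2
  have hm0 : (m : ℝ) = 0 := by linarith
  simpa [hm0] using hm x

theorem stronglyReversible_of_iterate {f : S1 ≃ₜ S1} (hf : OrientationPreserving f) {n : ℕ}
    (hn : 0 < n) (hper : ∃ x, (⇑f)^[n] x = x) {τ : S1 ≃ₜ S1} (ho : OrientationReversing τ)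
    (hτ : IsInvolution τ) (hrev : ∀ x, τ ((⇑f)^[n] (τ x)) = (⇑f.symm)^[n] x) :
    StronglyReversible f := by
  obtain ⟨F, hF⟩ := hf
  obtain ⟨θ, hanti, h1, hθ⟩ := ho
  have hsurj := surjective_of_lift (d := -1) rfl (by simpa [sub_eq_add_neg] using h1) hθ
  have hθc : Continuous θ :=
    (Monotone.continuous_of_surjective (α := ℝᵒᵈ) hanti.antitone.dual_left hsurj)
  have hθθ : ∀ x, θ (θ x) = x := by
    obtain ⟨m, hm⟩ := exists_int_add_of_coe_eq (hθc.comp hθc) continuous_id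
      (fun x => by simp only [Function.comp_apply, id]; rw [← hθ, ← hθ, hτ])
    simp only [Function.comp_apply, id] at hm
    intro x
    have h2 := map_add_intCast (d := -1) (by simpa [sub_eq_add_neg] using h1) x m
    have h3 := (hm (θ x)).symm.trans (congrArg θ (hm x))
    push_cast at h2
    have hm0 : (m : ℝ) = 0 := by linarith
    simpa [hm0] using hm x
  have hFθ := iterate_conj_lift_eq hF hper hrev hτ hθc h1 hθ
  have hinj : Function.Injective F := by
    intro a b hab
    obtain ⟨k, rfl⟩ := Nat.exists_eq_succ_of_ne_zero hn.ne'
    apply hanti.injective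
    rw [← hFθ a, ← hFθ b, Function.iterate_succ_apply F k a, hab, ← Function.iterate_succ_apply]
  have hΘΘ := maxConj_maxConj F.monotone hinj hanti.antitone hθθ hFθ
  have hFΘ := map_maxConj_map F.monotone hn hFθ
  obtain ⟨σ, hσ⟩ := exists_homeomorph_of_involution (continuous_maxConj hF.continuous hθc)
    (maxConj_add_one (n := n) F.map_add_one h1) hΘΘ
  have hσσ : IsInvolution σ := fun x => by
    obtain ⟨x, rfl⟩ := QuotientAddGroup.mk_surjective x
    rw [hσ, hσ, hΘΘ]
  refine ⟨σ, hσσ, fun x => ?_⟩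
  obtain ⟨x, rfl⟩ := QuotientAddGroup.mk_surjective x
  rw [Homeomorph.eq_symm_apply]
  rw [hσ, hF, hσ, hF, hFΘ, hΘΘ]

/-- An orientation preserving circle homeomorphism with non-zero rational rotation
number (i.e. with a periodic point of minimal period `n > 1`) is strongly reversible in
`Homeo(S¹)` iff `f^{n_f}` is strongly reversible by an orientation reversing involution. -/
theorem stmt17 (f : S1 ≃ₜ S1) (hf : OrientationPreserving f) (n : ℕ) (hn : 1 < n)
    (hper : ∃ x, (⇑f)^[n] x = x)
    (hmin : ∀ m : ℕ, 0 < m → m < n → ¬∃ x, (⇑f)^[m] x = x) :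
    StronglyReversible f ↔
      ∃ τ : S1 ≃ₜ S1, OrientationReversing τ ∧ IsInvolution τ ∧
        ∀ x, τ ((⇑f)^[n] (τ x)) = (⇑f.symm)^[n] x := by
  refine ⟨exists_orientationReversing_of_stronglyReversible hf hn hmin, ?_⟩
  rintro ⟨τ, ho, hτ, hrev⟩
  exact stronglyReversible_of_iterate hf (by omega) hper ho hτ hrev
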